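/- Let (Ω, Σ, μ) be a σ-finite measure space and f ∈ L¹(μ) with ‖f‖₁ = 1 such that the support of f contains no atom for μ. Then f is a Daugavet point: for every ε > 0 one has B_{L¹(μ)} = cl conv{g ∈ B_{L¹(μ)} : ‖f − g‖₁ ≥ 2 − ε}. -/

import Mathlib

open MeasureTheory

/-- `A` is an atom for the measure `μ`. -/
def IsMeasureAtom {Ω : Type*} [MeasurableSpace Ω] (μ : Measure Ω) (A : Set Ω) : Prop :=
  MeasurableSet A ∧ 0 < μ A ∧ μ A < ⊤ ∧
    ∀ B : Set Ω, MeasurableSet B → B ⊆ A → μ B = 0 ∨ μ B = μ A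

namespace DaugAux

open Set Filter Topology

/-- The cone predicate generated by `K`. -/
def InCone {E : Type*} [NormedAddCommGroup E] [NormedSpace ℝ E] (K : Set E) (g : E) : Prop :=
  g = 0 ∨ ‖g‖⁻¹ • g ∈ K

theorem inCone_add {E : Type*} [NormedAddCommGroup E] [NormedSpace ℝ E] {K : Set E}
    (hK : Convex ℝ K) {g h : E} (hg : InCone K g) (hh : InCone K h)
    (hn : ‖g + h‖ = ‖g‖ + ‖h‖) : InCone K (g + h) := by
  by_cases g0 : g = 0
  · subst g0; simpa using hh
  by_cases h0 : h = 0
  · subst h0; simpa using hg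
  have hg' := hg.resolve_left g0
  have hh' := hh.resolve_left h0
  have pg : 0 < ‖g‖ := norm_pos_iff.2 g0
  have ph : 0 < ‖h‖ := norm_pos_iff.2 h0
  right
  have := hK hg' hh' (a := ‖g‖ / (‖g‖ + ‖h‖)) (b := ‖h‖ / (‖g‖ + ‖h‖)) (by positivity)
    (by positivity) (by field_simp)
  convert this using 1
  rw [hn, smul_add, smul_smul, smul_smul]
  congr 2 <;> field_simp

theorem isClosed_inCone {E : Type*} [NormedAddCommGroup E] [NormedSpace ℝ E] {K : Set E}
    (hK : IsClosed K) : IsClosed {g | InCone K g} := by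
  refine isClosed_iff_clusterPt.2 fun g hg => ?_
  by_cases g0 : g = 0
  · exact Or.inl g0
  right
  have hc : ContinuousAt (fun x : E => ‖x‖⁻¹ • x) g :=
    (continuousAt_id.norm.inv₀ (norm_ne_zero_iff.2 g0)).smul continuousAt_id
  rw [← mem_closure_iff_clusterPt, mem_closure_iff_frequently] at hg
  have h1 : ∀ᶠ x in 𝓝 g, x ≠ 0 := isOpen_ne.mem_nhds g0
  have h2 : ∃ᶠ x in 𝓝 g, ‖x‖⁻¹ • x ∈ K :=
    (hg.and_eventually h1).mono fun x hx => hx.1.resolve_left hx.2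
  exact hK.mem_of_frequently_of_tendsto h2 hc

variable {Ω : Type*} [MeasurableSpace Ω] {μ : Measure Ω}

theorem norm_add_disjoint {f g : Lp ℝ 1 μ} (h : ∀ᵐ x ∂μ, f x = 0 ∨ g x = 0) :
    ‖f + g‖ = ‖f‖ + ‖g‖ := by
  rw [L1.norm_eq_integral_norm, L1.norm_eq_integral_norm, L1.norm_eq_integral_norm,
    ← integral_add (L1.integrable_coeFn f).norm (L1.integrable_coeFn g).norm]
  refine integral_congr_ae ?_
  filter_upwards [h, Lp.coeFn_add f g] with x hx h2
  rw [h2]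
  rcases hx with hx | hx <;> simp [hx]

theorem norm_sub_ge {f h : Lp ℝ 1 μ} {B : Set Ω} (hB : MeasurableSet B)
    (hh : ∀ᵐ x ∂μ, x ∉ B → h x = 0) :
    ‖f‖ + ‖h‖ - 2 * ∫ x in B, ‖f x‖ ∂μ ≤ ‖f - h‖ := by
  have If := (L1.integrable_coeFn f).norm
  have Ih := (L1.integrable_coeFn h).norm
  rw [L1.norm_eq_integral_norm, L1.norm_eq_integral_norm, L1.norm_eq_integral_norm,
    ← integral_add' If Ih, ← integral_indicator hB, ← integral_const_mul,
    ← integral_sub (If.add Ih) ((If.indicator hB).const_mul 2)]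
  refine integral_mono_ae ((If.add Ih).sub ((If.indicator hB).const_mul 2))
    (L1.integrable_coeFn (f - h)).norm ?_
  filter_upwards [hh, Lp.coeFn_sub f h] with x hx h2
  simp only [h2, Pi.sub_apply, Pi.add_apply]
  by_cases xB : x ∈ B
  · simp only [xB, indicator_of_mem]
    have := norm_sub_norm_le (h x) (f x)
    rw [norm_sub_rev] at this
    linarith
  · simp [xB, hx xB]

theorem exists_half (f : Lp ℝ 1 μ)
    (hsupp : ∀ A : Set Ω, IsMeasureAtom μ A →
      ¬ (∀ᵐ x ∂(μ.restrict A), (f : Ω → ℝ) x ≠ 0)) {E : Set Ω} (hE : MeasurableSet E)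
    (h0 : 0 < μ E) (ht : μ E < ⊤) :
    ∃ A ⊆ E, MeasurableSet A ∧ 0 < μ A ∧ ∫ x in A, ‖f x‖ ∂μ ≤ (∫ x in E, ‖f x‖ ∂μ) / 2 := by
  by_cases hat : IsMeasureAtom μ E
  · have hm : MeasurableSet {x | f x = 0} :=
      (Lp.stronglyMeasurable f).measurable (measurableSet_singleton 0)
    refine ⟨{x | f x = 0} ∩ E, inter_subset_right, hm.inter hE, ?_, ?_⟩
    · have := hsupp E hat
      rw [ae_iff] at this
      simp only [ne_eq, not_not] at this
      rw [Measure.restrict_apply hm] at this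
      exact pos_iff_ne_zero.2 this
    · rw [setIntegral_congr_fun (g := fun _ => (0 : ℝ)) (hm.inter hE)
        (fun x hx => by simpa using hx.1)]
      simp only [integral_zero]
      have : 0 ≤ ∫ x in E, ‖f x‖ ∂μ := integral_nonneg fun x => norm_nonneg _
      positivity
  · have : ∃ B, MeasurableSet B ∧ B ⊆ E ∧ μ B ≠ 0 ∧ μ B ≠ μ E := by
      by_contra hcon
      push Not at hcon
      refine hat ⟨hE, h0, ht, fun B hB hBE => ?_⟩
      by_cases hb : μ B = 0
      · exact Or.inl hb
      · exact Or.inr (hcon B hB hBE hb)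
    obtain ⟨B, hB, hBE, hb0, hbE⟩ := this
    have hd : 0 < μ (E \ B) := by
      rw [measure_sdiff hBE hB.nullMeasurableSet ((measure_mono hBE).trans_lt ht).ne]
      exact tsub_pos_of_lt (lt_of_le_of_ne (measure_mono hBE) hbE)
    have hs := integral_inter_add_sdiff (μ := μ) (s := E) hB
      (L1.integrable_coeFn f).norm.integrableOn
    rw [inter_eq_self_of_subset_right hBE] at hs
    by_cases hle : ∫ x in B, ‖f x‖ ∂μ ≤ (∫ x in E, ‖f x‖ ∂μ) / 2
    · exact ⟨B, hBE, hB, pos_iff_ne_zero.2 hb0, hle⟩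
    · exact ⟨E \ B, sdiff_subset, hE.diff hB, hd, by linarith⟩

theorem exists_small (f : Lp ℝ 1 μ)
    (hsupp : ∀ A : Set Ω, IsMeasureAtom μ A →
      ¬ (∀ᵐ x ∂(μ.restrict A), (f : Ω → ℝ) x ≠ 0)) {E : Set Ω} (hE : MeasurableSet E)
    (h0 : 0 < μ E) (ht : μ E < ⊤) {δ : ℝ} (hδ : 0 < δ) :
    ∃ A ⊆ E, MeasurableSet A ∧ 0 < μ A ∧ ∫ x in A, ‖f x‖ ∂μ ≤ δ := by
  have key : ∀ n : ℕ, ∃ A ⊆ E, MeasurableSet A ∧ 0 < μ A ∧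
      ∫ x in A, ‖f x‖ ∂μ ≤ (∫ x in E, ‖f x‖ ∂μ) * (1 / 2) ^ n := by
    intro n
    induction n with
    | zero => exact ⟨E, Subset.rfl, hE, h0, by simp⟩
    | succ n ih =>
      obtain ⟨A, hAE, hA, hA0, hAl⟩ := ih
      obtain ⟨B, hBA, hB, hB0, hBl⟩ := exists_half f hsupp hA hA0 ((measure_mono hAE).trans_lt ht)
      refine ⟨B, hBA.trans hAE, hB, hB0, hBl.trans ?_⟩
      rw [pow_succ]; linarith
  have hl : Tendsto (fun n : ℕ => (∫ x in E, ‖f x‖ ∂μ) * (1 / 2 : ℝ) ^ n) atTop (𝓝 0) := by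
    simpa using (tendsto_pow_atTop_nhds_zero_of_lt_one (r := (1 / 2 : ℝ)) (by norm_num)
      (by norm_num)).const_mul (∫ x in E, ‖f x‖ ∂μ)
  obtain ⟨n, hn⟩ := (hl.eventually (gt_mem_nhds hδ)).exists
  obtain ⟨A, h1, h2, h3, h4⟩ := key n
  exact ⟨A, h1, h2, h3, h4.trans hn.le⟩

theorem exhaust (G : Set Ω → Prop) {E : Set Ω} (hE : MeasurableSet E) (ht : μ E < ⊤)
    (h0 : G ∅) (hU : ∀ A : ℕ → Set Ω, (∀ n, MeasurableSet (A n)) → (∀ n, G (A n)) → G (⋃ n, A n))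
    (hS : ∀ F ⊆ E, MeasurableSet F → 0 < μ F → ∃ A ⊆ F, MeasurableSet A ∧ 0 < μ A ∧ G A) :
    ∃ U ⊆ E, MeasurableSet U ∧ G U ∧ μ (E \ U) = 0 := by
  let S : Set ENNReal := μ '' {A | MeasurableSet A ∧ A ⊆ E ∧ G A}
  have hSne : S.Nonempty := ⟨_, ∅, ⟨MeasurableSet.empty, empty_subset _, h0⟩, rfl⟩
  obtain ⟨u, -, hu, huS⟩ := exists_seq_tendsto_sSup hSne (OrderTop.bddAbove S)
  choose A hA hAu using huS
  have hUE : (⋃ n, A n) ⊆ E := iUnion_subset fun n => (hA n).2.1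
  have hUm : MeasurableSet (⋃ n, A n) := MeasurableSet.iUnion fun n => (hA n).1
  have hUG : G (⋃ n, A n) := hU A (fun n => (hA n).1) fun n => (hA n).2.2
  refine ⟨⋃ n, A n, hUE, hUm, hUG, ?_⟩
  by_contra hne
  obtain ⟨B, hB, hBm, hB0, hBG⟩ := hS (E \ ⋃ n, A n) sdiff_subset (hE.diff hUm)
    (pos_iff_ne_zero.2 hne)
  have hle : sSup S ≤ μ (⋃ n, A n) :=
    le_of_tendsto' hu fun n => (hAu n) ▸ measure_mono (subset_iUnion A n)
  have hdis : Disjoint (⋃ n, A n) B := by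
    rw [Set.disjoint_left]; intro x hx hxB; exact (hB hxB).2 hx
  have hG2 : G ((⋃ n, A n) ∪ B) := by
    have := hU (fun n => if n = 0 then ⋃ n, A n else B)
      (fun n => by split_ifs <;> assumption)
      (fun n => by split_ifs <;> assumption)
    convert this using 1
    ext x
    simp only [mem_union, mem_iUnion (s := fun n => if n = 0 then ⋃ n, A n else B)]
    constructor
    · rintro (h | h)
      · exact ⟨0, by simpa using h⟩
      · exact ⟨1, by simpa using h⟩
    · rintro ⟨n, hn⟩
      split_ifs at hn
      · exact Or.inl hn
      · exact Or.inr hn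
  have hle2 : μ ((⋃ n, A n) ∪ B) ≤ sSup S :=
    le_sSup ⟨_, ⟨hUm.union hBm, union_subset hUE (hB.trans sdiff_subset), hG2⟩, rfl⟩
  rw [measure_union hdis hBm] at hle2
  have hfin : μ (⋃ n, A n) ≠ ⊤ := ((measure_mono hUE).trans_lt ht).ne
  exact absurd (hle2.trans hle) (not_le.2 (ENNReal.lt_add_right hfin hB0.ne'))

/-- all subsets of `A` have their indicators in the cone -/
def Good (μ : Measure Ω) (K : Set (Lp ℝ 1 μ)) (A : Set Ω) : Prop :=
  ∀ (B : Set Ω) (hB : MeasurableSet B) (hμ : μ B ≠ ⊤) (c : ℝ), B ⊆ A →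
    InCone K (indicatorConstLp 1 hB hμ c)

theorem indicator_split {K : Set (Lp ℝ 1 μ)} (hK : Convex ℝ K) {A B : Set Ω}
    (hA : MeasurableSet A) (hB : MeasurableSet B) (hμA : μ A ≠ ⊤) (hμB : μ B ≠ ⊤)
    (hd : Disjoint A B) (c : ℝ) (h1 : InCone K (indicatorConstLp 1 hA hμA c))
    (h2 : InCone K (indicatorConstLp 1 hB hμB c)) :
    InCone K (indicatorConstLp 1 (hA.union hB) (by finiteness) c) := by
  rw [indicatorConstLp_disjoint_union hA hB hμA hμB hd]
  refine inCone_add hK h1 h2 (norm_add_disjoint ?_)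
  filter_upwards [indicatorConstLp_coeFn_notMem (p := 1) (hs := hA) (hμs := hμA) (c := c),
    indicatorConstLp_coeFn_notMem (p := 1) (hs := hB) (hμs := hμB) (c := c)] with x hx hy
  by_cases hxA : x ∈ A
  · exact Or.inr (hy (Set.disjoint_left.1 hd hxA))
  · exact Or.inl (hx hxA)

theorem good_union {K : Set (Lp ℝ 1 μ)} (hK : Convex ℝ K) {A A' : Set Ω}
    (hA : MeasurableSet A) (h1 : Good μ K A) (h2 : Good μ K A') :
    Good μ K (A ∪ A') := by
  intro B hB hμ c hBA
  have m1 : μ (B ∩ A) ≠ ⊤ := ne_top_of_le_ne_top hμ (measure_mono inter_subset_left)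
  have m2 : μ (B \ A) ≠ ⊤ := ne_top_of_le_ne_top hμ (measure_mono sdiff_subset)
  have := indicator_split hK (hB.inter hA) (hB.diff hA) m1 m2
    (disjoint_sdiff_right.mono_left inter_subset_right) c
    (h1 _ _ m1 c inter_subset_right)
    (h2 _ _ m2 c (fun x hx => (hBA hx.1).resolve_left hx.2))
  simpa only [inter_union_sdiff] using this

theorem good_iUnion {K : Set (Lp ℝ 1 μ)} (hK : Convex ℝ K) (hKc : IsClosed K) (A : ℕ → Set Ω)
    (hA : ∀ n, MeasurableSet (A n)) (hG : ∀ n, Good μ K (A n)) : Good μ K (⋃ n, A n) := by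
  have hm : ∀ n, MeasurableSet (accumulate A n) := by
    intro n
    rw [accumulate_def]
    exact MeasurableSet.biUnion (to_countable _) fun i _ => hA i
  have hacc : ∀ n, Good μ K (accumulate A n) := by
    intro n
    induction n with
    | zero => simpa [accumulate] using hG 0
    | succ n ih =>
      rw [accumulate_succ]
      exact good_union hK (hm n) ih (hG _)
  intro B hB hμ c hBA
  have m1 : ∀ n, μ (B ∩ accumulate A n) ≠ ⊤ :=
    fun n => ne_top_of_le_ne_top hμ (measure_mono inter_subset_left)
  have hl : Tendsto (fun n => μ (symmDiff (B ∩ accumulate A n) B)) atTop (𝓝 0) := by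
    have he : ∀ n, symmDiff (B ∩ accumulate A n) B = B \ accumulate A n := by
      intro n; ext x; simp only [mem_symmDiff, mem_inter_iff, Set.mem_sdiff]; tauto
    simp only [he]
    have := tendsto_measure_iInter_atTop (μ := μ) (s := fun n => B \ accumulate A n)
      (fun n => (hB.diff (hm n)).nullMeasurableSet)
      (fun i j hij => sdiff_subset_sdiff_right (monotone_accumulate hij))
      ⟨0, ne_top_of_le_ne_top hμ (measure_mono sdiff_subset)⟩
    rwa [← sdiff_iUnion, iUnion_accumulate, sdiff_eq_empty.2 hBA, measure_empty] at this
  have ht := tendsto_indicatorConstLp_set (p := 1) (c := c) (hs := hB) (hμs := hμ)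
    (ht := fun n => hB.inter (hm n)) (hμt := m1) (by simp) hl
  exact (isClosed_inCone hKc).mem_of_tendsto ht
    (Eventually.of_forall fun n => hacc n _ _ (m1 n) c inter_subset_right)

theorem good_small (f : Lp ℝ 1 μ) (hf : ‖f‖ = 1) {ε : ℝ} {A : Set Ω}
    (hAm : ∫ x in A, ‖f x‖ ∂μ ≤ ε / 2) {K : Set (Lp ℝ 1 μ)}
    (hK : {g : Lp ℝ 1 μ | ‖g‖ ≤ 1 ∧ 2 - ε ≤ ‖f - g‖} ⊆ K) : Good μ K A := by
  intro B hB hμ c hBA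
  by_cases h0 : indicatorConstLp 1 hB hμ c = 0
  · exact Or.inl h0
  right
  apply hK
  set h := indicatorConstLp 1 hB hμ c with hh
  have hn : ‖‖h‖⁻¹ • h‖ = 1 := by
    rw [norm_smul, norm_inv, norm_norm, inv_mul_cancel₀ (norm_ne_zero_iff.2 h0)]
  refine ⟨hn.le, ?_⟩
  have key := norm_sub_ge (f := f) (h := ‖h‖⁻¹ • h) hB (by
    filter_upwards [indicatorConstLp_coeFn_notMem (p := 1) (hs := hB) (hμs := hμ) (c := c),
      Lp.coeFn_smul (‖h‖⁻¹) h] with x hx h2 hxB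
    rw [h2, Pi.smul_apply, hh, hx hxB, smul_zero])
  have hmono : ∫ x in B, ‖f x‖ ∂μ ≤ ∫ x in A, ‖f x‖ ∂μ :=
    setIntegral_mono_set (L1.integrable_coeFn f).norm.integrableOn
      (Eventually.of_forall fun x => norm_nonneg _) hBA.eventuallyLE
  rw [hf, hn] at key
  linarith

theorem inCone_indicator (f : Lp ℝ 1 μ) (hf : ‖f‖ = 1)
    (hsupp : ∀ A : Set Ω, IsMeasureAtom μ A →
      ¬ (∀ᵐ x ∂(μ.restrict A), (f : Ω → ℝ) x ≠ 0)) {ε : ℝ} (hε : 0 < ε)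
    {K : Set (Lp ℝ 1 μ)} (hKc : Convex ℝ K) (hKcl : IsClosed K)
    (hK : {g : Lp ℝ 1 μ | ‖g‖ ≤ 1 ∧ 2 - ε ≤ ‖f - g‖} ⊆ K) (c : ℝ) {E : Set Ω}
    (hE : MeasurableSet E) (ht : μ E < ⊤) : InCone K (indicatorConstLp 1 hE ht.ne c) := by
  obtain ⟨U, hUE, hUm, hUG, hU0⟩ := exhaust (μ := μ) (Good μ K) hE ht
    (good_small f hf (by simp; positivity) hK) (fun A hA hG => good_iUnion hKc hKcl A hA hG)
    (fun F hF hFm hF0 => by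
      obtain ⟨A, h1, h2, h3, h4⟩ := exists_small f hsupp hFm hF0
        ((measure_mono hF).trans_lt ht) (half_pos hε)
      exact ⟨A, h1, h2, h3, good_small f hf h4 hK⟩)
  have hUt : μ U ≠ ⊤ := ((measure_mono hUE).trans_lt ht).ne
  have := hUG U hUm hUt c Subset.rfl
  convert this using 1
  ext1
  have hae : E =ᵐ[μ] U := by
    refine Filter.EventuallyLE.antisymm ?_ hUE.eventuallyLE
    exact ae_le_set.2 hU0
  exact indicatorConstLp_coeFn.trans
    ((indicator_ae_eq_of_ae_eq_set hae).trans indicatorConstLp_coeFn.symm)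

theorem inCone_all {K : Set (Lp ℝ 1 μ)} (hKc : Convex ℝ K) (hKcl : IsClosed K)
    (hi : ∀ (c : ℝ) {E : Set Ω} (hE : MeasurableSet E) (ht : μ E < ⊤),
      InCone K (indicatorConstLp 1 hE ht.ne c)) (g : Lp ℝ 1 μ) : InCone K g := by
  refine Lp.induction (by simp) (motive := fun g => InCone K g) ?_ ?_ (isClosed_inCone hKcl) g
  · intro c s hs hμs
    exact hi c hs hμs
  · intro f g hf hg hd h1 h2
    refine inCone_add hKc h1 h2 (norm_add_disjoint ?_)
    filter_upwards [hf.coeFn_toLp, hg.coeFn_toLp] with x hx hy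
    rw [hx, hy]
    by_contra hcon
    push Not at hcon
    exact Set.disjoint_left.1 hd hcon.1 hcon.2

end DaugAux

/-- If `f ∈ L¹(μ)` (`μ` σ-finite) has norm one and its support contains no atom
of `μ` (i.e. no atom is a.e. contained in `{f ≠ 0}`), then `f` is a Daugavet
point: `B_{L¹(μ)} = cl conv Δ_ε(f)` for every `ε > 0`. -/
theorem stmt_7 {Ω : Type*} [MeasurableSpace Ω] (μ : Measure Ω) [SigmaFinite μ]
    (f : Lp ℝ 1 μ) (hf : ‖f‖ = 1)
    (hsupp : ∀ A : Set Ω, IsMeasureAtom μ A →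
      ¬ (∀ᵐ x ∂(μ.restrict A), (f : Ω → ℝ) x ≠ 0)) :
    ∀ ε > (0 : ℝ),
      Metric.closedBall (0 : Lp ℝ 1 μ) 1 =
        closure (convexHull ℝ {g : Lp ℝ 1 μ | ‖g‖ ≤ 1 ∧ 2 - ε ≤ ‖f - g‖}) := by
  intro ε hε
  set D := {g : Lp ℝ 1 μ | ‖g‖ ≤ 1 ∧ 2 - ε ≤ ‖f - g‖} with hD
  have hKc : Convex ℝ (closure (convexHull ℝ D)) := (convex_convexHull ℝ D).closure
  have hDK : D ⊆ closure (convexHull ℝ D) := (subset_convexHull ℝ D).trans subset_closure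
  have hall : ∀ g : Lp ℝ 1 μ, DaugAux.InCone (closure (convexHull ℝ D)) g :=
    DaugAux.inCone_all hKc isClosed_closure fun c E hE ht =>
      DaugAux.inCone_indicator f hf hsupp hε hKc isClosed_closure hDK c hE ht
  have hfK : f ∈ closure (convexHull ℝ D) := by
    rcases hall f with h | h
    · rw [h, norm_zero] at hf; norm_num at hf
    · simpa [hf] using h
  have hnK : -f ∈ closure (convexHull ℝ D) := by
    refine hDK ⟨by rw [norm_neg, hf], ?_⟩
    rw [sub_neg_eq_add, ← two_smul ℝ f, norm_smul, hf]
    norm_num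
    exact hε.le
  have h0 : (0 : Lp ℝ 1 μ) ∈ closure (convexHull ℝ D) := by
    have := hKc hfK hnK (a := 1 / 2) (b := 1 / 2) (by norm_num) (by norm_num) (by norm_num)
    simpa using this
  apply Set.Subset.antisymm
  · intro g hg
    rw [mem_closedBall_zero_iff] at hg
    rcases hall g with h | h
    · rw [h]; exact h0
    · by_cases g0 : g = 0
      · rw [g0]; exact h0
      have := hKc h h0 (a := ‖g‖) (b := 1 - ‖g‖) (norm_nonneg _) (by linarith) (by ring)
      rwa [smul_zero, add_zero, smul_smul, mul_inv_cancel₀ (norm_ne_zero_iff.2 g0), one_smul]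
        at this
  · refine closure_minimal (convexHull_min ?_ (convex_closedBall 0 1)) Metric.isClosed_closedBall
    intro g hg
    exact mem_closedBall_zero_iff.2 hg.1
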